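/- Let (x_i[n])_{i=1}^I, n ≥ 0, be the sequences generated by the inexact NEXT algorithm under Assumptions A, F, B, with step sizes α[n] ∈ (0, 1], Σ_n α[n] = ∞, Σ_n α[n]² < ∞, and error sequences (ε_i[n])_n nonnegative, uniformly bounded, with Σ_n α[n] ε_i[n] < ∞ for every i. Let x̄[n] := (1/I) Σ_{i=1}^I x_i[n], let x̃_i[n] be the exact best responses of the algorithm, and let x̃_i^av[n] be defined by the auxiliary averaged recursions. Then for every i = 1,…,I: (i) lim_{n→∞} ‖x̃_i[n] − x̃_i^av[n]‖ = 0, and (ii) Σ_{n=1}^∞ α[n] ‖x̃_i[n] − x̃_i^av[n]‖ < ∞. -/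

import Mathlib

open Filter
open scoped InnerProductSpace

/-- Sequences whose squares are summable. -/
def SquareSummable (u : ℕ → ℝ) : Prop := Summable fun n => u n ^ 2

namespace SquareSummable

variable {u v : ℕ → ℝ}

lemma of_le (hv : SquareSummable v) (h0 : ∀ n, 0 ≤ u n) (h : ∀ n, u n ≤ v n) :
    SquareSummable u :=
  Summable.of_nonneg_of_le (fun _ => sq_nonneg _) (fun n => pow_le_pow_left₀ (h0 n) (h n) 2) hv

lemma add (hu : SquareSummable u) (hv : SquareSummable v) :
    SquareSummable fun n => u n + v n :=
  Summable.of_nonneg_of_le (fun _ => sq_nonneg _)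
    (fun n => by nlinarith [sq_nonneg (u n - v n)]) ((hu.mul_left 2).add (hv.mul_left 2))

lemma const_mul (c : ℝ) (hu : SquareSummable u) : SquareSummable fun n => c * u n := by
  simpa only [SquareSummable, mul_pow] using Summable.mul_left (c ^ 2) hu

lemma shift (k : ℕ) (hu : SquareSummable u) : SquareSummable fun n => u (n + k) :=
  (summable_nat_add_iff (f := fun n => u n ^ 2) k).2 hu

lemma sum {ι : Type*} (s : Finset ι) {w : ι → ℕ → ℝ} (h : ∀ i ∈ s, SquareSummable (w i)) :
    SquareSummable fun n => ∑ i ∈ s, w i n := by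
  classical
  induction s using Finset.induction_on with
  | empty => simp [SquareSummable, summable_zero]
  | insert a s ha ih =>
    simp only [Finset.sum_insert ha]
    exact (h a (Finset.mem_insert_self a s)).add
      (ih fun i hi => h i (Finset.mem_insert_of_mem hi))

lemma summable_mul (hu : SquareSummable u) (hv : SquareSummable v) (hu0 : ∀ n, 0 ≤ u n)
    (hv0 : ∀ n, 0 ≤ v n) : Summable fun n => u n * v n :=
  Summable.of_nonneg_of_le (fun n => mul_nonneg (hu0 n) (hv0 n))
    (fun n => by nlinarith [sq_nonneg (u n - v n), sq_nonneg (u n), sq_nonneg (v n)])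
    (Summable.add hu hv)

lemma tendsto_zero (hu : SquareSummable u) : Tendsto u atTop (nhds 0) := by
  have h := Summable.tendsto_atTop_zero hu
  rw [tendsto_zero_iff_abs_tendsto_zero]
  have h2 := (Real.continuous_sqrt.tendsto 0).comp h
  simpa [Function.comp_def, Real.sqrt_sq_eq_abs] using h2

/-- A `T`-step contraction driven by a square-summable input is square-summable. -/
lemma of_delayed_contraction {T : ℕ} {ρ : ℝ} (hρ0 : 0 ≤ ρ) (hρ1 : ρ < 1)
    (hu0 : ∀ n, 0 ≤ u n) (h : ∀ n, u (n + T) ≤ ρ * u n + v n)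
    (hv : SquareSummable v) : SquareSummable u := by
  have hsq : ∀ n, u (n + T) ^ 2 ≤ ρ * u n ^ 2 + (1 - ρ)⁻¹ * v n ^ 2 := fun n => by
    have h1 : 0 < 1 - ρ := by linarith
    have h2 : (1 - ρ) * (1 - ρ)⁻¹ = 1 := mul_inv_cancel₀ h1.ne'
    have h3 : u (n + T) ^ 2 ≤ (ρ * u n + v n) ^ 2 := pow_le_pow_left₀ (hu0 _) (h n) 2
    have h4 : 0 ≤ ρ * (1 - ρ) * (u n - (1 - ρ)⁻¹ * v n) ^ 2 := by positivity
    have h5 : ρ * u n ^ 2 + (1 - ρ)⁻¹ * v n ^ 2 - (ρ * u n + v n) ^ 2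
        = ρ * (1 - ρ) * (u n - (1 - ρ)⁻¹ * v n) ^ 2 := by
      field_simp
      ring
    linarith
  set c := ∑ n ∈ Finset.range T, u n ^ 2
  set d := ∑' n, (1 - ρ)⁻¹ * v n ^ 2
  have hd : Summable fun n => (1 - ρ)⁻¹ * v n ^ 2 := Summable.mul_left _ hv
  refine summable_of_sum_range_le (c := (c + d) / (1 - ρ)) (fun _ => sq_nonneg _) fun N => ?_
  have h1 : ∑ n ∈ Finset.range N, u n ^ 2 ≤ ∑ n ∈ Finset.range (T + N), u n ^ 2 :=
    Finset.sum_le_sum_of_subset_of_nonneg (Finset.range_mono (by omega))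
      fun _ _ _ => sq_nonneg _
  rw [Finset.sum_range_add] at h1
  have h2 : ∑ n ∈ Finset.range N, u (T + n) ^ 2 ≤
      ρ * ∑ n ∈ Finset.range N, u n ^ 2 + ∑ n ∈ Finset.range N, (1 - ρ)⁻¹ * v n ^ 2 := by
    rw [Finset.mul_sum, ← Finset.sum_add_distrib]
    exact Finset.sum_le_sum fun n _ => by rw [add_comm T n]; exact hsq n
  have h3 : ∑ n ∈ Finset.range N, (1 - ρ)⁻¹ * v n ^ 2 ≤ d :=
    hd.sum_le_tsum _ fun n _ => mul_nonneg (inv_nonneg.2 (by linarith)) (sq_nonneg _)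
  rw [le_div_iff₀ (by linarith)]
  linarith

end SquareSummable

/-- A `T`-step contraction driven by a bounded input is bounded. -/
lemma exists_bound_of_delayed_contraction {u : ℕ → ℝ} {T : ℕ} (hT : 0 < T) {ρ M : ℝ}
    (hρ0 : 0 ≤ ρ) (hρ1 : ρ < 1) (hM : 0 ≤ M) (hu0 : ∀ n, 0 ≤ u n)
    (h : ∀ n, u (n + T) ≤ ρ * u n + M) : ∃ C, ∀ n, u n ≤ C := by
  have hM' : M / (1 - ρ) = ρ * (M / (1 - ρ)) + M := by
    have : 1 - ρ ≠ 0 := by linarith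
    field_simp
    ring
  have hsum : 0 ≤ ∑ n ∈ Finset.range T, u n := Finset.sum_nonneg fun n _ => hu0 n
  have hdiv : 0 ≤ M / (1 - ρ) := div_nonneg hM (by linarith)
  refine ⟨∑ n ∈ Finset.range T, u n + M / (1 - ρ), fun n => ?_⟩
  induction n using Nat.strong_induction_on with
  | _ n ih =>
    rcases lt_or_ge n T with hn | hn
    · linarith [Finset.single_le_sum (fun k _ => hu0 k) (Finset.mem_range.2 hn)]
    · have h1 := h (n - T)
      rw [Nat.sub_add_cancel hn] at h1
      have h2 := mul_le_mul_of_nonneg_left (ih (n - T) (by omega)) hρ0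
      nlinarith [mul_le_mul_of_nonneg_right hρ1.le hsum]

/-- Doubly stochastic weights with entries in `{0} ∪ [θ, ∞)` whose graphs are jointly strongly
connected over consecutive windows of length `B`. -/
structure JointlyConnectedWeights {ι : Type*} [Fintype ι] (θ : ℝ) (B : ℕ) (W : ℕ → ι → ι → ℝ) :
    Prop where
  pos : 0 < θ
  le_of_pos : ∀ n i j, 0 < W n i j → θ ≤ W n i j
  nonneg : ∀ n i j, 0 ≤ W n i j
  diag : ∀ n i, θ ≤ W n i i
  row : ∀ n i, ∑ j, W n i j = 1
  col : ∀ n j, ∑ i, W n i j = 1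
  connected : ∀ (k : ℕ) (a b : ι), Relation.ReflTransGen
    (fun u v => ∃ n ∈ Finset.Ico (k * B) ((k + 1) * B), 0 < W n v u) a b

/-- The product `W (s + k - 1) ⋯ W s`. -/
def transition {ι : Type*} [Fintype ι] [DecidableEq ι] (W : ℕ → ι → ι → ℝ) (s : ℕ) :
    ℕ → ι → ι → ℝ
  | 0, i, j => if i = j then 1 else 0
  | k + 1, i, j => ∑ l, W (s + k) i l * transition W s k l j

/-- Deviations of a family of vectors from its average. -/
noncomputable def centered {ι E : Type*} [Fintype ι] [AddCommGroup E] [Module ℝ E] (v : ι → E)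
    (i : ι) : E :=
  v i - (Fintype.card ι : ℝ)⁻¹ • ∑ j, v j

lemma sum_centered {ι E : Type*} [Fintype ι] [Nonempty ι] [AddCommGroup E] [Module ℝ E]
    (v : ι → E) : ∑ i, centered v i = 0 := by
  have h : (Fintype.card ι : ℝ) ≠ 0 := by simp
  simp only [centered, Finset.sum_sub_distrib, Finset.sum_const, Finset.card_univ]
  rw [← Nat.cast_smul_eq_nsmul ℝ, smul_smul, mul_inv_cancel₀ h, one_smul, sub_self]

lemma sum_norm_centered_le {ι E : Type*} [Fintype ι] [Nonempty ι] [NormedAddCommGroup E]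
    [NormedSpace ℝ E] (v : ι → E) : ∑ i, ‖centered v i‖ ≤ 2 * ∑ i, ‖v i‖ := by
  have h : (0 : ℝ) < Fintype.card ι := by simp [Fintype.card_pos]
  calc ∑ i, ‖centered v i‖
      ≤ ∑ i, (‖v i‖ + (Fintype.card ι : ℝ)⁻¹ * ∑ j, ‖v j‖) := by
        refine Finset.sum_le_sum fun i _ => (norm_sub_le _ _).trans ?_
        rw [norm_smul, norm_inv, Real.norm_natCast]
        gcongr
        exact norm_sum_le _ _
    _ = 2 * ∑ i, ‖v i‖ := by
        rw [Finset.sum_add_distrib, Finset.sum_const, Finset.card_univ, nsmul_eq_mul]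
        field_simp
        ring

/-- A column-stochastic matrix with entries at least `η` contracts families with zero sum. -/
lemma sum_norm_le_of_col_stochastic {ι E : Type*} [Fintype ι] [NormedAddCommGroup E]
    [NormedSpace ℝ E] {P : ι → ι → ℝ} {η : ℝ}
    (hη : ∀ i j, η ≤ P i j) (hcol : ∀ j, ∑ i, P i j = 1) {w : ι → E} (hw : ∑ j, w j = 0) :
    ∑ i, ‖∑ j, P i j • w j‖ ≤ (1 - Fintype.card ι * η) * ∑ j, ‖w j‖ := by
  calc ∑ i, ‖∑ j, P i j • w j‖ = ∑ i, ‖∑ j, (P i j - η) • w j‖ := by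
        simp only [sub_smul, Finset.sum_sub_distrib, ← Finset.smul_sum, hw, smul_zero, sub_zero]
    _ ≤ ∑ i, ∑ j, (P i j - η) * ‖w j‖ := by
        refine Finset.sum_le_sum fun i _ => (norm_sum_le _ _).trans_eq ?_
        simp only [norm_smul, Real.norm_of_nonneg (sub_nonneg.2 (hη _ _))]
    _ = (1 - Fintype.card ι * η) * ∑ j, ‖w j‖ := by
        rw [Finset.sum_comm, Finset.mul_sum]
        simp only [← Finset.sum_mul, Finset.sum_sub_distrib, hcol, Finset.sum_const,
          Finset.card_univ, nsmul_eq_mul]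

namespace JointlyConnectedWeights

variable {ι : Type*} [Fintype ι] {θ : ℝ} {B : ℕ} {W : ℕ → ι → ι → ℝ}

section Transition

variable [DecidableEq ι]

lemma transition_nonneg (hW : JointlyConnectedWeights θ B W) (s k : ℕ) (i j : ι) :
    0 ≤ transition W s k i j := by
  induction k generalizing i with
  | zero => simp only [transition]; split_ifs <;> norm_num
  | succ k ih =>
    exact Finset.sum_nonneg fun l _ => mul_nonneg (hW.nonneg _ _ _) (ih l)

lemma transition_col (hW : JointlyConnectedWeights θ B W) (s k : ℕ) (j : ι) :
    ∑ i, transition W s k i j = 1 := by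
  induction k with
  | zero => simp [transition]
  | succ k ih =>
    simp only [transition]
    rw [Finset.sum_comm]
    simp only [← Finset.sum_mul, hW.col, one_mul, ih]

lemma pow_le_transition_succ (hW : JointlyConnectedWeights θ B W) {s k : ℕ} {u v j : ι}
    (hu : θ ^ k ≤ transition W s k u j) (huv : 0 < W (s + k) v u) :
    θ ^ (k + 1) ≤ transition W s (k + 1) v j := by
  have hθ := hW.pos
  calc θ ^ (k + 1) = θ * θ ^ k := pow_succ' θ k
    _ ≤ W (s + k) v u * transition W s k u j :=
        mul_le_mul (hW.le_of_pos _ _ _ huv) hu (by positivity) (hW.nonneg _ _ _)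
    _ ≤ transition W s (k + 1) v j :=
        Finset.single_le_sum (f := fun l => W (s + k) v l * transition W s k l j)
          (fun l _ => mul_nonneg (hW.nonneg _ _ _) (hW.transition_nonneg _ _ _ _))
          (Finset.mem_univ u)

lemma pow_le_transition_mono (hW : JointlyConnectedWeights θ B W) {s k k' : ℕ} {i j : ι}
    (hk : k ≤ k') (h : θ ^ k ≤ transition W s k i j) : θ ^ k' ≤ transition W s k' i j := by
  induction k', hk using Nat.le_induction with
  | base => exact h
  | succ k' _ ih => exact hW.pow_le_transition_succ ih (hW.pos.trans_le (hW.diag _ _))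

lemma pow_le_transition (hW : JointlyConnectedWeights θ B W) (s : ℕ) (i j : ι) :
    θ ^ ((Fintype.card ι + 1) * B) ≤ transition W s ((Fintype.card ι + 1) * B) i j := by
  classical
  rcases Nat.eq_zero_or_pos B with hB | hB
  · subst hB
    have h := hW.connected 0 j i
    simp only [mul_zero, Finset.Ico_self, Finset.notMem_empty, false_and, exists_false] at h
    have : j = i := by
      induction h with
      | refl => rfl
      | tail _ h _ => exact h.elim
    simp [this, transition]
  set S : ℕ → Finset ι := fun k => Finset.univ.filter fun i => θ ^ k ≤ transition W s k i j
    with hS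
  have hmemS : ∀ k i, i ∈ S k ↔ θ ^ k ≤ transition W s k i j := fun k i => by simp [hS]
  have hmono : ∀ {k k'}, k ≤ k' → S k ⊆ S k' := fun hk i hi =>
    (hmemS _ _).2 (hW.pow_le_transition_mono hk ((hmemS _ _).1 hi))
  have hj : ∀ k, j ∈ S k := fun k =>
    hmono (Nat.zero_le k) ((hmemS 0 j).2 (by simp [transition]))
  have hgrow : ∀ q, s ≤ q * B → S ((q + 1) * B - s) ⊆ S (q * B - s) →
      S (q * B - s) = Finset.univ := by
    intro q hq hsub
    refine Finset.eq_univ_of_forall fun b => ?_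
    induction hW.connected q j b with
    | refl => exact hj _
    | tail _ huv ih =>
      obtain ⟨n, hn, hpos⟩ := huv
      rw [Finset.mem_Ico] at hn
      have hu := (hmemS _ _).1 (hmono (show q * B - s ≤ n - s by omega) ih)
      have hv := hW.pow_le_transition_succ hu
        (by rwa [Nat.add_sub_cancel' (by omega : s ≤ n)])
      exact hsub (hmono (by omega) ((hmemS _ _).2 hv))
  obtain ⟨q₀, hs, hs'⟩ : ∃ q, s ≤ q * B ∧ q * B ≤ s + B := by
    refine ⟨s / B + 1, ?_, ?_⟩ <;> rw [add_mul, one_mul] <;>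
      have := Nat.div_add_mod' s B <;> have := Nat.mod_lt s hB <;> omega
  have hcard : ∀ k, S ((q₀ + k) * B - s) = Finset.univ ∨ k < (S ((q₀ + k) * B - s)).card := by
    intro k
    induction k with
    | zero => exact Or.inr (Finset.card_pos.2 ⟨j, hj _⟩)
    | succ k ih =>
      have hle : (q₀ + k) * B ≤ (q₀ + (k + 1)) * B := Nat.mul_le_mul_right B (by omega)
      have hsub : S ((q₀ + k) * B - s) ⊆ S ((q₀ + (k + 1)) * B - s) := hmono (by omega)
      by_cases hu : S ((q₀ + k) * B - s) = Finset.univ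
      · exact Or.inl (Finset.univ_subset_iff.1 (hu ▸ hsub))
      · right
        have hlt := ih.resolve_left hu
        have hss : S ((q₀ + k) * B - s) ⊂ S ((q₀ + (k + 1)) * B - s) :=
          ⟨hsub, fun h => hu (hgrow (q₀ + k)
            (hs.trans (Nat.mul_le_mul_right B (by omega))) h)⟩
        have := Finset.card_lt_card hss
        omega
  have huniv : S ((q₀ + Fintype.card ι) * B - s) = Finset.univ :=
    (hcard _).resolve_right (Finset.card_le_univ _).not_gt
  have hmem : i ∈ S ((q₀ + Fintype.card ι) * B - s) := huniv ▸ Finset.mem_univ i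
  refine (hmemS _ _).1 (hmono ?_ hmem)
  rw [add_mul, add_mul, one_mul]
  omega

end Transition

variable {E : Type*} [NormedAddCommGroup E] [NormedSpace ℝ E]

/-- Averaging does not increase the total norm. -/
lemma sum_norm_average_le (hW : JointlyConnectedWeights θ B W) (n : ℕ) (w : ι → E) :
    ∑ i, ‖∑ j, W n i j • w j‖ ≤ ∑ j, ‖w j‖ := by
  calc ∑ i, ‖∑ j, W n i j • w j‖ ≤ ∑ i, ∑ j, W n i j * ‖w j‖ := by
        refine Finset.sum_le_sum fun i _ => (norm_sum_le _ _).trans_eq ?_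
        simp only [norm_smul, Real.norm_of_nonneg (hW.nonneg _ _ _)]
    _ = ∑ j, ‖w j‖ := by
        rw [Finset.sum_comm]
        simp only [← Finset.sum_mul, hW.col, one_mul]

lemma sum_average (hW : JointlyConnectedWeights θ B W) (n : ℕ) (w : ι → E) :
    ∑ i, ∑ j, W n i j • w j = ∑ j, w j := by
  rw [Finset.sum_comm]
  simp only [← Finset.sum_smul, hW.col, one_smul]

lemma sum_norm_sub_transition_le [DecidableEq ι] (hW : JointlyConnectedWeights θ B W)
    {w δ : ℕ → ι → E} (hrec : ∀ n i, w (n + 1) i = ∑ j, W n i j • w n j + δ n i) (s k : ℕ) :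
    ∑ i, ‖w (s + k) i - ∑ j, transition W s k i j • w s j‖
      ≤ ∑ l ∈ Finset.range k, ∑ i, ‖δ (s + l) i‖ := by
  induction k with
  | zero => simp [transition]
  | succ k ih =>
    have hstep : ∀ i, w (s + (k + 1)) i - ∑ j, transition W s (k + 1) i j • w s j =
        ∑ l, W (s + k) i l • (w (s + k) l - ∑ j, transition W s k l j • w s j)
          + δ (s + k) i := by
      intro i
      rw [← add_assoc, hrec]
      simp only [transition, smul_sub, Finset.sum_sub_distrib, Finset.sum_smul, Finset.smul_sum,
        smul_smul]
      rw [Finset.sum_comm (f := fun x i_1 => (W (s + k) i i_1 * transition W s k i_1 x) • w s x)]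
      abel
    rw [Finset.sum_range_succ]
    calc ∑ i, ‖w (s + (k + 1)) i - ∑ j, transition W s (k + 1) i j • w s j‖
        ≤ ∑ i, (‖∑ l, W (s + k) i l • (w (s + k) l - ∑ j, transition W s k l j • w s j)‖
          + ‖δ (s + k) i‖) :=
          Finset.sum_le_sum fun i _ => by rw [hstep]; exact norm_add_le _ _
      _ ≤ _ := by
          rw [Finset.sum_add_distrib]
          exact add_le_add ((hW.sum_norm_average_le _ _).trans ih) le_rfl

/-- Dynamic tracking preserves the sum of the tracked signals. -/
lemma sum_tracking (hW : JointlyConnectedWeights θ B W) {v p : ℕ → ι → E} (h0 : ∀ i, v 0 i = p 0 i)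
    (hrec : ∀ n i, v (n + 1) i = ∑ j, W n i j • v n j + (p (n + 1) i - p n i)) (n : ℕ) :
    ∑ i, v n i = ∑ i, p n i := by
  induction n with
  | zero => simp only [h0]
  | succ n ih =>
    simp only [hrec, Finset.sum_add_distrib, hW.sum_average, ih, Finset.sum_sub_distrib]
    abel

lemma norm_tracking_le (hW : JointlyConnectedWeights θ B W) {v p : ℕ → ι → E}
    (h0 : ∀ i, v 0 i = p 0 i)
    (hrec : ∀ n i, v (n + 1) i = ∑ j, W n i j • v n j + (p (n + 1) i - p n i)) (n : ℕ) (i : ι) :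
    ‖v n i‖ ≤ ‖centered (v n) i‖ + ∑ j, ‖p n j‖ := by
  have h1 : v n i = centered (v n) i + (Fintype.card ι : ℝ)⁻¹ • ∑ j, p n j := by
    rw [← hW.sum_tracking h0 hrec n, centered, sub_add_cancel]
  have h2 : ‖(Fintype.card ι : ℝ)⁻¹ • ∑ j, p n j‖ ≤ ∑ j, ‖p n j‖ := by
    rw [norm_smul, norm_inv, Real.norm_natCast]
    refine (mul_le_of_le_one_left (norm_nonneg _) (Nat.cast_inv_le_one _)).trans
      (norm_sum_le _ _)
  calc ‖v n i‖ = ‖centered (v n) i + (Fintype.card ι : ℝ)⁻¹ • ∑ j, p n j‖ := congrArg _ h1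
    _ ≤ _ := (norm_add_le _ _).trans (add_le_add le_rfl h2)

variable [Nonempty ι]

/-- The disagreement of a perturbed consensus iteration is a delayed contraction. -/
lemma exists_contraction (hW : JointlyConnectedWeights θ B W) (hB : 0 < B) :
    ∃ (T : ℕ) (ρ : ℝ), 0 < T ∧ 0 ≤ ρ ∧ ρ < 1 ∧ ∀ v δ : ℕ → ι → E,
      (∀ n i, v (n + 1) i = ∑ j, W n i j • v n j + δ n i) → ∀ n,
      ∑ i, ‖centered (v (n + T)) i‖ ≤ ρ * ∑ i, ‖centered (v n) i‖
        + ∑ l ∈ Finset.range T, 2 * ∑ i, ‖δ (n + l) i‖ := by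
  classical
  set T := (Fintype.card ι + 1) * B
  have hθ := hW.pos
  have hcard : (0 : ℝ) < Fintype.card ι := by simp [Fintype.card_pos]
  refine ⟨T, 1 - Fintype.card ι * θ ^ T, by positivity, ?_, ?_, ?_⟩
  · inhabit ι
    have h := Finset.sum_le_sum fun i (_ : i ∈ Finset.univ) =>
      hW.pow_le_transition 0 i (default : ι)
    rw [hW.transition_col, Finset.sum_const, Finset.card_univ, nsmul_eq_mul] at h
    linarith
  · have : 0 < Fintype.card ι * θ ^ T := by positivity
    linarith
  · intro v δ hrec n
    have hrec' : ∀ n i, centered (v (n + 1)) i =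
        ∑ j, W n i j • centered (v n) j + centered (δ n) i := by
      intro n i
      simp only [centered, hrec, Finset.sum_add_distrib, hW.sum_average, smul_sub,
        Finset.sum_sub_distrib, ← Finset.sum_smul, hW.row, one_smul, smul_add]
      abel
    have h1 := hW.sum_norm_sub_transition_le (w := fun n => centered (v n))
      (δ := fun n => centered (δ n)) hrec' n T
    have h2 := sum_norm_le_of_col_stochastic (hW.pow_le_transition n) (hW.transition_col n T)
      (sum_centered (v n))
    calc ∑ i, ‖centered (v (n + T)) i‖
        ≤ ∑ i, (‖∑ j, transition W n T i j • centered (v n) j‖ +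
            ‖centered (v (n + T)) i - ∑ j, transition W n T i j • centered (v n) j‖) :=
          Finset.sum_le_sum fun i _ => norm_le_norm_add_norm_sub' _ _
      _ ≤ _ := by
          rw [Finset.sum_add_distrib]
          exact add_le_add h2
            (h1.trans (Finset.sum_le_sum fun l _ => sum_norm_centered_le _))

lemma squareSummable_centered (hW : JointlyConnectedWeights θ B W) (hB : 0 < B)
    {v δ : ℕ → ι → E} (hrec : ∀ n i, v (n + 1) i = ∑ j, W n i j • v n j + δ n i)
    (hδ : ∀ i, SquareSummable fun n => ‖δ n i‖) (i : ι) :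
    SquareSummable fun n => ‖centered (v n) i‖ := by
  obtain ⟨T, ρ, -, hρ0, hρ1, h⟩ := hW.exists_contraction (E := E) hB
  have hsum : SquareSummable fun n => ∑ i, ‖centered (v n) i‖ := by
    refine SquareSummable.of_delayed_contraction hρ0 hρ1
      (fun n => Finset.sum_nonneg fun i _ => norm_nonneg _) (h v δ hrec) ?_
    exact SquareSummable.sum _ fun l _ => SquareSummable.const_mul 2
      (SquareSummable.shift l (u := fun n => ∑ i, ‖δ n i‖) (SquareSummable.sum _ fun i _ => hδ i))
  exact hsum.of_le (fun n => norm_nonneg _) fun n =>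
    Finset.single_le_sum (f := fun i => ‖centered (v n) i‖) (fun _ _ => norm_nonneg _)
      (Finset.mem_univ i)

lemma exists_norm_centered_le (hW : JointlyConnectedWeights θ B W) (hB : 0 < B)
    {v δ : ℕ → ι → E} (hrec : ∀ n i, v (n + 1) i = ∑ j, W n i j • v n j + δ n i)
    {D : ℝ} (hD : 0 ≤ D) (hδ : ∀ n i, ‖δ n i‖ ≤ D) :
    ∃ C, ∀ n i, ‖centered (v n) i‖ ≤ C := by
  obtain ⟨T, ρ, hT, hρ0, hρ1, h⟩ := hW.exists_contraction (E := E) hB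
  obtain ⟨C, hC⟩ := exists_bound_of_delayed_contraction
    (u := fun n => ∑ i, ‖centered (v n) i‖) hT hρ0 hρ1
    (M := ∑ _l ∈ Finset.range T, 2 * ∑ _i : ι, D) (by positivity)
    (fun n => Finset.sum_nonneg fun i _ => norm_nonneg _) (fun n => (h v δ hrec n).trans
      (by gcongr; exact hδ _ _))
  exact ⟨C, fun n i => (Finset.single_le_sum (f := fun i => ‖centered (v n) i‖)
    (fun _ _ => norm_nonneg _) (Finset.mem_univ i)).trans (hC n)⟩

/-- Tracking of bounded signals stays bounded. -/
lemma exists_norm_tracking_le (hW : JointlyConnectedWeights θ B W) (hB : 0 < B) {v p : ℕ → ι → E}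
    (h0 : ∀ i, v 0 i = p 0 i)
    (hrec : ∀ n i, v (n + 1) i = ∑ j, W n i j • v n j + (p (n + 1) i - p n i))
    {D : ℝ} (hD : 0 ≤ D) (hp : ∀ n i, ‖p n i‖ ≤ D) : ∃ C, ∀ n i, ‖v n i‖ ≤ C := by
  obtain ⟨C, hC⟩ := hW.exists_norm_centered_le hB
    (δ := fun n i => p (n + 1) i - p n i) hrec (add_nonneg hD hD)
    fun n i => (norm_sub_le _ _).trans (add_le_add (hp _ _) (hp _ _))
  exact ⟨C + ∑ _j : ι, D, fun n i => (hW.norm_tracking_le h0 hrec n i).trans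
    (add_le_add (hC n i) (Finset.sum_le_sum fun j _ => hp n j))⟩

/-- Tracking of square-summable signals is square-summable. -/
lemma squareSummable_tracking (hW : JointlyConnectedWeights θ B W) (hB : 0 < B)
    {v p : ℕ → ι → E} (h0 : ∀ i, v 0 i = p 0 i)
    (hrec : ∀ n i, v (n + 1) i = ∑ j, W n i j • v n j + (p (n + 1) i - p n i))
    (hp : ∀ i, SquareSummable fun n => ‖p n i‖) (i : ι) : SquareSummable fun n => ‖v n i‖ := by
  have hδ : ∀ i, SquareSummable fun n => ‖p (n + 1) i - p n i‖ := fun i =>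
    (((hp i).shift 1).add (hp i)).of_le (fun _ => norm_nonneg _) fun _ => norm_sub_le _ _
  exact ((hW.squareSummable_centered hB hrec hδ i).add
    (SquareSummable.sum _ fun j _ => hp j)).of_le (fun _ => norm_nonneg _)
    fun n => hW.norm_tracking_le h0 hrec n i

end JointlyConnectedWeights

section BestResponse

variable {E : Type*} [NormedAddCommGroup E] [InnerProductSpace ℝ E]

lemma ConvexOn.exists_subgradient [FiniteDimensional ℝ E] {G : E → ℝ}
    (hG : ConvexOn ℝ Set.univ G) (x : E) : ∃ g : E, ∀ y, G x + ⟪g, y - x⟫_ℝ ≤ G y := by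
  have hcont : Continuous G := continuousOn_univ.1 (hG.continuousOn isOpen_univ)
  have hopen : IsOpen {p : E × ℝ | p.1 ∈ Set.univ ∧ G p.1 < p.2} := by
    simpa using isOpen_lt (hcont.comp continuous_fst) continuous_snd
  obtain ⟨l, hl⟩ := geometric_hahn_banach_open_point hG.convex_strict_epigraph hopen
    (x := (x, G x)) (by simp)
  have hsplit : ∀ (y : E) (t : ℝ), l (y, t) = l (y, 0) + t * l (0, 1) := fun y t => by
    rw [← smul_eq_mul, ← map_smul, ← map_add]
    simp
  have hneg : l (0, 1) < 0 := by
    have h := hl (x, G x + 1) (by simp)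
    rw [hsplit x (G x + 1), hsplit x (G x)] at h
    linarith
  have hle : ∀ y, l (y, 0) + G y * l (0, 1) ≤ l (x, 0) + G x * l (0, 1) := fun y => by
    refine le_of_forall_pos_lt_add fun e he => ?_
    have h := hl (y, G y + e / -l (0, 1)) ⟨trivial, by
      have : 0 < e / -l (0, 1) := div_pos he (by linarith)
      simpa using this⟩
    rw [hsplit y, hsplit x (G x)] at h
    have h2 : e / -l (0, 1) * l (0, 1) = -e := by
      rw [div_neg, neg_mul, div_mul_cancel₀ _ hneg.ne]
    linarith
  refine ⟨(-l (0, 1))⁻¹ •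
    (InnerProductSpace.toDual ℝ E).symm (l.comp (ContinuousLinearMap.inl ℝ E ℝ)), fun y => ?_⟩
  rw [real_inner_smul_left, InnerProductSpace.toDual_symm_apply]
  have h0 : 0 < -l (0, 1) := by linarith
  have h1 : l (y - x, 0) = l (y, 0) - l (x, 0) := by rw [← map_sub]; simp
  simp only [ContinuousLinearMap.comp_apply, ContinuousLinearMap.inl_apply, h1]
  rw [← le_sub_iff_add_le', inv_mul_le_iff₀ h0]
  linarith [hle y]

variable {K : Set E} {τ : ℝ}

/-- A minimizer of a strongly convex function satisfies a quadratic growth condition. -/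
lemma StrongConvexOn.quadratic_growth {h : E → ℝ} (hh : StrongConvexOn K τ h) {a u : E}
    (ha : a ∈ K) (hu : u ∈ K) (hmin : ∀ v ∈ K, h a ≤ h v) :
    h a + τ / 4 * ‖a - u‖ ^ 2 ≤ h u := by
  have h0 : (0 : ℝ) ≤ 1 / 2 := by norm_num
  have h1 := hh.2 ha hu h0 h0 (add_halves 1)
  have h2 := hmin _ (hh.1 ha hu h0 h0 (add_halves 1))
  simp only [smul_eq_mul] at h1
  linarith

lemma ConvexOn.add_inner_le [CompleteSpace E] {φ : E → ℝ} (hφ : ConvexOn ℝ K φ) {x a g : E}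
    (hx : x ∈ K) (ha : a ∈ K) (hg : HasGradientAt φ g x) : φ x + ⟪g, a - x⟫_ℝ ≤ φ a := by
  have hmaps : Set.MapsTo (AffineMap.lineMap x a : ℝ → E) (Set.Icc 0 1) K :=
    fun t ht => hφ.1.lineMap_mem hx ha ht
  have hconv : ConvexOn ℝ (Set.Icc (0 : ℝ) 1) (φ ∘ (AffineMap.lineMap x a : ℝ →ᵃ[ℝ] E)) :=
    (hφ.comp_affineMap _).subset hmaps (convex_Icc 0 1)
  have hderiv : HasDerivAt (φ ∘ (AffineMap.lineMap x a : ℝ → E)) ⟪g, a - x⟫_ℝ 0 := by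
    have h1 : HasFDerivAt φ (InnerProductSpace.toDual ℝ E g)
        ((AffineMap.lineMap x a : ℝ → E) 0) := by
      simpa using hg.hasFDerivAt
    simpa using h1.comp_hasDerivAt (0 : ℝ) AffineMap.hasDerivAt_lineMap
  have h := hconv.le_slope_of_hasDerivAt (by simp) (by simp) zero_lt_one hderiv
  simp only [slope_def_field, Function.comp_apply, AffineMap.lineMap_apply_one,
    AffineMap.lineMap_apply_zero, sub_zero, div_one] at h
  linarith

variable {φ ψ G : E → ℝ} {a b x z p q : E}

lemma StrongConvexOn.add_inner_add (hφ : StrongConvexOn K τ φ) (hG : ConvexOn ℝ K G) (p x : E) :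
    StrongConvexOn K τ fun u => φ u + ⟪p, u - x⟫_ℝ + G u := by
  have hlin : ConvexOn ℝ K fun u => ⟪p, u - x⟫_ℝ := by
    refine ⟨hφ.1, fun u _ v _ s t _ _ hst => le_of_eq ?_⟩
    obtain rfl : t = 1 - s := by linarith
    simp only [inner_sub_right, inner_add_right, real_inner_smul_right, smul_eq_mul]
    ring
  have := UniformConvexOn.add hφ (uniformConvexOn_zero.2 (hlin.add hG))
  simpa [StrongConvexOn, add_assoc, Pi.add_def] using this

/-- Stability of strongly convex best responses under perturbation of the objective. -/
lemma norm_bestResponse_sub_le (hφ : StrongConvexOn K τ φ) (hψ : StrongConvexOn K τ ψ)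
    (hτ : 0 < τ) (hG : ConvexOn ℝ K G) (ha : a ∈ K) (hb : b ∈ K)
    (hamin : ∀ u ∈ K, φ a + ⟪p, a - x⟫_ℝ + G a ≤ φ u + ⟪p, u - x⟫_ℝ + G u)
    (hbmin : ∀ u ∈ K, ψ b + ⟪q, b - z⟫_ℝ + G b ≤ ψ u + ⟪q, u - z⟫_ℝ + G u)
    {C : ℝ} (hC0 : 0 ≤ C) (hC : (φ b - ψ b) - (φ a - ψ a) ≤ C * ‖b - a‖) :
    ‖a - b‖ ≤ 2 / τ * (C + ‖p - q‖) := by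
  have h1 := (hφ.add_inner_add hG p x).quadratic_growth ha hb hamin
  have h2 := (hψ.add_inner_add hG q z).quadratic_growth hb ha hbmin
  have h3 : ⟪p - q, b - a⟫_ℝ ≤ ‖p - q‖ * ‖b - a‖ := real_inner_le_norm _ _
  rw [norm_sub_rev b a] at h2 h3 hC
  simp only [inner_sub_left, inner_sub_right] at h1 h2 h3
  rcases (norm_nonneg (a - b)).eq_or_lt with h0 | h0
  · rw [← h0]
    positivity
  · have h4 : τ / 2 * ‖a - b‖ * ‖a - b‖ ≤ (C + ‖p - q‖) * ‖a - b‖ := by nlinarith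
    have h5 := le_of_mul_le_mul_right h4 h0
    rw [div_mul_eq_mul_div, le_div_iff₀ hτ]
    linarith

/-- A best response stays within a bounded distance of its base point. -/
lemma norm_bestResponse_sub_base_le [CompleteSpace E] (hφ : StrongConvexOn K τ φ) (hτ : 0 < τ)
    (hG : ConvexOn ℝ K G) (ha : a ∈ K) (hx : x ∈ K)
    (hamin : ∀ u ∈ K, φ a + ⟪p, a - x⟫_ℝ + G a ≤ φ u + ⟪p, u - x⟫_ℝ + G u)
    {g s : E} (hg : HasGradientAt φ g x) (hs : G x + ⟪s, a - x⟫_ℝ ≤ G a) :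
    ‖a - x‖ ≤ 4 / τ * (‖g‖ + ‖p‖ + ‖s‖) := by
  have h1 := (hφ.add_inner_add hG p x).quadratic_growth ha hx hamin
  have h2 := (hφ.strictConvexOn hτ).convexOn.add_inner_le hx ha hg
  have hle : ∀ w : E, -⟪w, a - x⟫_ℝ ≤ ‖w‖ * ‖a - x‖ := fun w =>
    (neg_le_abs _).trans (abs_real_inner_le_norm _ _)
  have h3 := hle g
  have h4 := hle p
  have h5 := hle s
  simp only [sub_self, inner_zero_right, add_zero] at h1
  rcases (norm_nonneg (a - x)).eq_or_lt with h0 | h0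
  · rw [← h0]
    positivity
  · have h6 : τ / 4 * ‖a - x‖ * ‖a - x‖ ≤ (‖g‖ + ‖p‖ + ‖s‖) * ‖a - x‖ := by nlinarith
    have h7 := le_of_mul_le_mul_right h6 h0
    rw [div_mul_eq_mul_div, le_div_iff₀ hτ]
    linarith

end BestResponse

/-- Asymptotic agreement on best responses in the inexact NEXT algorithm: `‖x̃_i[n] − x̃_i^av[n]‖ → 0` and is summable against the step sizes. -/
theorem stmt_14 {m I : ℕ} (hI : 0 < I)
    (K : Set (EuclideanSpace ℝ (Fin m)))
    (hKne : K.Nonempty) (hKcl : IsClosed K) (hKcv : Convex ℝ K)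
    (f : Fin I → EuclideanSpace ℝ (Fin m) → ℝ)
    (gf : Fin I → EuclideanSpace ℝ (Fin m) → EuclideanSpace ℝ (Fin m))
    (Uo : Set (EuclideanSpace ℝ (Fin m))) (hUo : IsOpen Uo) (hKUo : K ⊆ Uo)
    (hdiff : ∀ i, ∀ x ∈ Uo, HasGradientAt (f i) (gf i x) x)
    (hgradcont : ∀ i, ContinuousOn (gf i) Uo)
    (L : Fin I → ℝ)
    (hLip : ∀ i, ∀ x ∈ K, ∀ y ∈ K, ‖gf i x - gf i y‖ ≤ L i * ‖x - y‖)
    (LF : ℝ) (hLF : 0 < LF)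
    (hgb : ∀ i, ∀ x ∈ K, ‖gf i x‖ ≤ LF)
    (G : EuclideanSpace ℝ (Fin m) → ℝ) (hG : ConvexOn ℝ Set.univ G)
    (LG : ℝ)
    (hsub : ∀ x ∈ K, ∀ g, (∀ y, G x + ⟪g, y - x⟫_ℝ ≤ G y) → ‖g‖ ≤ LG)
    (hcoer : ∀ c : ℝ, ∃ r : ℝ, ∀ x ∈ K, r ≤ ‖x‖ → c ≤ (∑ i, f i x) + G x)
    (ft : Fin I → EuclideanSpace ℝ (Fin m) → EuclideanSpace ℝ (Fin m) → ℝ)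
    (gft : Fin I → EuclideanSpace ℝ (Fin m) → EuclideanSpace ℝ (Fin m) → EuclideanSpace ℝ (Fin m))
    (τ : Fin I → ℝ) (hτ : ∀ i, 0 < τ i)
    (hF1 : ∀ i, ∀ z ∈ K, StrongConvexOn K (τ i) (fun x => ft i x z))
    (hftgrad : ∀ i, ∀ z ∈ K, ∀ x ∈ K, HasGradientAt (fun u => ft i u z) (gft i x z) x)
    (hF2 : ∀ i, ∀ x ∈ K, gft i x x = gf i x)
    (Lt : ℝ)
    (hF3 : ∀ i, ∀ x ∈ K, ∀ w ∈ K, ∀ z ∈ K, ‖gft i x w - gft i x z‖ ≤ Lt * ‖w - z‖)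
    (θ : ℝ) (hθ : θ ∈ Set.Ioo (0 : ℝ) 1)
    (W : ℕ → Fin I → Fin I → ℝ)
    (hWentries : ∀ n i j, W n i j = 0 ∨ W n i j ∈ Set.Icc θ 1)
    (hWdiag : ∀ n i, θ ≤ W n i i)
    (hWrow : ∀ n i, ∑ j, W n i j = 1)
    (hWcol : ∀ n j, ∑ i, W n i j = 1)
    (B : ℕ) (hB : 0 < B)
    (hconn : ∀ k : ℕ, ∀ a b : Fin I,
      Relation.ReflTransGen
        (fun u v : Fin I => ∃ n ∈ Finset.Ico (k * B) ((k + 1) * B), 0 < W n v u) a b)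
    (α : ℕ → ℝ) (hα : ∀ n, α n ∈ Set.Ioc (0 : ℝ) 1)
    (hαdiv : ¬ Summable α)
    (hαsq : Summable (fun n => (α n) ^ 2))
    (x xt y πt : Fin I → ℕ → EuclideanSpace ℝ (Fin m))
    (hx0 : ∀ i, x i 0 ∈ K)
    (hy0 : ∀ i, y i 0 = gf i (x i 0))
    (hπt : ∀ i n, πt i n = (I : ℝ) • y i n - gf i (x i n))
    (hxt : ∀ i n, xt i n ∈ K ∧ ∀ u ∈ K, u ≠ xt i n →
      ft i (xt i n) (x i n) + ⟪πt i n, xt i n - x i n⟫_ℝ + G (xt i n)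
        < ft i u (x i n) + ⟪πt i n, u - x i n⟫_ℝ + G u)
    (hyrec : ∀ i n, y i (n + 1) = (∑ j, W n i j • y j n) + gf i (x i (n + 1)) - gf i (x i n))
    (ε : Fin I → ℕ → ℝ) (hεnn : ∀ i n, 0 ≤ ε i n)
    (hεbd : ∃ Cb : ℝ, ∀ i n, ε i n ≤ Cb)
    (hεsum : ∀ i, Summable (fun n => α n * ε i n))
    (xinx : Fin I → ℕ → EuclideanSpace ℝ (Fin m))
    (hinx : ∀ i n, xinx i n ∈ K ∧ ‖xinx i n - xt i n‖ ≤ ε i n)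
    (hxrec : ∀ i n, x i (n + 1) = ∑ j, W n i j • (x j n + α n • (xinx j n - x j n)))
    (xbar : ℕ → EuclideanSpace ℝ (Fin m)) (hxbar : ∀ n, xbar n = (I : ℝ)⁻¹ • ∑ j, x j n)
    (yav πav xtav : Fin I → ℕ → EuclideanSpace ℝ (Fin m))
    (hyav0 : ∀ i, yav i 0 = gf i (xbar 0))
    (hyavrec : ∀ i n, yav i (n + 1) =
      (∑ j, W n i j • yav j n) + gf i (xbar (n + 1)) - gf i (xbar n))
    (hπav : ∀ i n, πav i n = (I : ℝ) • yav i n - gf i (xbar n))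
    (hxtav : ∀ i n, xtav i n ∈ K ∧ ∀ u ∈ K, u ≠ xtav i n →
      ft i (xtav i n) (xbar n) + ⟪πav i n, xtav i n - xbar n⟫_ℝ + G (xtav i n)
        < ft i u (xbar n) + ⟪πav i n, u - xbar n⟫_ℝ + G u) :
    ∀ i,
      Filter.Tendsto (fun n => ‖xt i n - xtav i n‖) Filter.atTop (nhds 0) ∧
      Summable (fun n => α n * ‖xt i n - xtav i n‖) := by
  intro i
  have : Nonempty (Fin I) := ⟨⟨0, hI⟩⟩
  have hWnn : ∀ n i j, 0 ≤ W n i j := fun n i j => by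
    rcases hWentries n i j with h | h
    · exact h.ge
    · exact hθ.1.le.trans h.1
  have hW : JointlyConnectedWeights θ B W :=
    { pos := hθ.1
      le_of_pos := fun n i j h => ((hWentries n i j).resolve_left h.ne').1
      nonneg := hWnn
      diag := hWdiag
      row := hWrow
      col := hWcol
      connected := hconn }
  have hGK : ConvexOn ℝ K G := hG.subset (Set.subset_univ K) hKcv
  have hxK : ∀ n i, x i n ∈ K := by
    intro n
    induction n with
    | zero => exact hx0
    | succ n ih =>
      intro i
      rw [hxrec]
      exact hKcv.sum_mem (fun j _ => hWnn n i j) (hWrow n i) fun j _ =>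
        hKcv.add_smul_sub_mem (ih j) (hinx j n).1 ⟨(hα n).1.le, (hα n).2⟩
  have hxbK : ∀ n, xbar n ∈ K := fun n => by
    rw [hxbar, Finset.smul_sum]
    refine hKcv.sum_mem (fun _ _ => by positivity) ?_ fun j _ => hxK n j
    simp [hI.ne']
  have hcen : ∀ i n, centered (fun j => x j n) i = x i n - xbar n := fun i n => by
    simp [centered, hxbar]
  have hxtmin : ∀ i n, ∀ u ∈ K,
      ft i (xt i n) (x i n) + ⟪πt i n, xt i n - x i n⟫_ℝ + G (xt i n)
        ≤ ft i u (x i n) + ⟪πt i n, u - x i n⟫_ℝ + G u := fun i n u hu => by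
    rcases eq_or_ne u (xt i n) with rfl | h
    · exact le_rfl
    · exact ((hxt i n).2 u hu h).le
  have hxtavmin : ∀ i n, ∀ u ∈ K,
      ft i (xtav i n) (xbar n) + ⟪πav i n, xtav i n - xbar n⟫_ℝ + G (xtav i n)
        ≤ ft i u (xbar n) + ⟪πav i n, u - xbar n⟫_ℝ + G u := fun i n u hu => by
    rcases eq_or_ne u (xtav i n) with rfl | h
    · exact le_rfl
    · exact ((hxtav i n).2 u hu h).le
  obtain ⟨Cy, hCy⟩ : ∃ C, ∀ n i, ‖y i n‖ ≤ C :=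
    hW.exists_norm_tracking_le hB (v := fun n i => y i n) (p := fun n i => gf i (x i n)) hy0
      (fun n i => by rw [hyrec, add_sub_assoc]) hLF.le fun n i => hgb i _ (hxK n i)
  have hstep : ∀ i, ∃ D, ∀ n, ‖xinx i n - x i n‖ ≤ D := by
    intro i
    obtain ⟨Cε, hCε⟩ := hεbd
    refine ⟨Cε + 4 / τ i * (LF + (I * Cy + LF) + LG), fun n => ?_⟩
    obtain ⟨s, hs⟩ := hG.exists_subgradient (x i n)
    have hbase := norm_bestResponse_sub_base_le (hF1 i _ (hxK n i)) (hτ i) hGK (hxt i n).1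
      (hxK n i) (hxtmin i n) (hftgrad i _ (hxK n i) _ (hxK n i)) (hs (xt i n))
    rw [hF2 i _ (hxK n i)] at hbase
    have hπ : ‖πt i n‖ ≤ I * Cy + LF := by
      rw [hπt]
      refine (norm_sub_le _ _).trans (add_le_add ?_ (hgb i _ (hxK n i)))
      rw [norm_smul, Real.norm_natCast]
      exact mul_le_mul_of_nonneg_left (hCy n i) (Nat.cast_nonneg I)
    calc ‖xinx i n - x i n‖ ≤ ‖xinx i n - xt i n‖ + ‖xt i n - x i n‖ :=
          norm_sub_le_norm_sub_add_norm_sub _ _ _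
      _ ≤ Cε + 4 / τ i * (LF + (I * Cy + LF) + LG) := by
          refine add_le_add ((hinx i n).2.trans (hCε i n)) (hbase.trans ?_)
          have := hτ i
          gcongr
          · exact hgb i _ (hxK n i)
          · exact hsub _ (hxK n i) s hs
  choose D hD using hstep
  have hD0 : ∀ j, 0 ≤ D j := fun j => (norm_nonneg _).trans (hD j 0)
  have hxdev : ∀ i, SquareSummable fun n => ‖x i n - xbar n‖ := by
    intro i
    simp only [← hcen]
    refine hW.squareSummable_centered hB (v := fun n j => x j n)
      (δ := fun n i => ∑ j, W n i j • α n • (xinx j n - x j n))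
      (fun n i => by simp only [hxrec, smul_add, Finset.sum_add_distrib]) (fun i => ?_) i
    refine SquareSummable.of_le (SquareSummable.const_mul (∑ j, D j) hαsq)
      (fun _ => norm_nonneg _) fun n => ?_
    rw [Finset.sum_mul]
    refine (norm_sum_le _ _).trans (Finset.sum_le_sum fun j _ => ?_)
    rw [norm_smul, norm_smul, Real.norm_of_nonneg (hWnn n i j), Real.norm_of_nonneg (hα n).1.le,
      mul_comm (D j)]
    have hW1 : W n i j ≤ 1 :=
      hWrow n i ▸ Finset.single_le_sum (fun k _ => hWnn n i k) (Finset.mem_univ j)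
    exact (mul_le_of_le_one_left (mul_nonneg (hα n).1.le (norm_nonneg _)) hW1).trans
      (mul_le_mul_of_nonneg_left (hD j n) (hα n).1.le)
  have hgdev : ∀ i, SquareSummable fun n => ‖gf i (x i n) - gf i (xbar n)‖ := fun i =>
    ((hxdev i).const_mul |L i|).of_le (fun _ => norm_nonneg _) fun n =>
      (hLip i _ (hxK n i) _ (hxbK n)).trans
        (mul_le_mul_of_nonneg_right (le_abs_self _) (norm_nonneg _))
  have hydev : SquareSummable fun n => ‖y i n - yav i n‖ :=
    hW.squareSummable_tracking hB (v := fun n i => y i n - yav i n)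
      (p := fun n i => gf i (x i n) - gf i (xbar n)) (fun i => by rw [hy0, hyav0])
      (fun n i => by
        simp only [hyrec, hyavrec, smul_sub, Finset.sum_sub_distrib]
        abel) hgdev i
  have hπdev : SquareSummable fun n => ‖πt i n - πav i n‖ := by
    refine ((hydev.const_mul I).add (hgdev i)).of_le (fun _ => norm_nonneg _) fun n => ?_
    have h : πt i n - πav i n =
        (I : ℝ) • (y i n - yav i n) - (gf i (x i n) - gf i (xbar n)) := by
      rw [hπt, hπav, smul_sub]
      abel
    rw [h]
    refine (norm_sub_le _ _).trans_eq ?_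
    rw [norm_smul, Real.norm_natCast]
  have hbr : ∀ n, ‖xt i n - xtav i n‖ ≤
      2 / τ i * (|Lt| * ‖x i n - xbar n‖ + ‖πt i n - πav i n‖) := by
    intro n
    refine norm_bestResponse_sub_le (hF1 i _ (hxK n i)) (hF1 i _ (hxbK n)) (hτ i) hGK (hxt i n).1
      (hxtav i n).1 (hxtmin i n) (hxtavmin i n) (by positivity) ?_
    refine (le_abs_self _).trans (hKcv.norm_image_sub_le_of_norm_hasFDerivWithin_le
      (f := fun u => ft i u (x i n) - ft i u (xbar n))
      (fun u hu => ((hftgrad i _ (hxK n i) u hu).hasFDerivAt.sub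
        (hftgrad i _ (hxbK n) u hu).hasFDerivAt).hasFDerivWithinAt)
      (fun u hu => ?_) (hxt i n).1 (hxtav i n).1)
    rw [← map_sub, LinearIsometryEquiv.norm_map]
    exact (hF3 i u hu _ (hxK n i) _ (hxbK n)).trans
      (mul_le_mul_of_nonneg_right (le_abs_self _) (norm_nonneg _))
  have hss : SquareSummable fun n => ‖xt i n - xtav i n‖ :=
    ((((hxdev i).const_mul |Lt|).add hπdev).const_mul (2 / τ i)).of_le
      (fun _ => norm_nonneg _) hbr
  exact ⟨hss.tendsto_zero, SquareSummable.summable_mul hαsq hss (fun n => (hα n).1.le)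
    fun _ => norm_nonneg _⟩
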